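/- If E_t is the inverse of a β-stable subordinator with β ∈ (0,1), then for every positive integer n, the n-th moment of E_t is E[E_t^n] = t^{nβ} · n! / Γ(nβ + 1). -/

import Mathlib

open MeasureTheory Real

section StableSubordinator

open Set Filter Topology ProbabilityTheory

/-- The moments of a `[0, 1]`-valued random variable determine its moment generating function. -/
lemma hasSum_mgf_of_mem_Icc {Ω : Type*} [MeasurableSpace Ω] {P : Measure Ω}
    [IsProbabilityMeasure P] {V : Ω → ℝ} (hV : AEMeasurable V P)
    (hV01 : ∀ᵐ ω ∂P, V ω ∈ Icc (0 : ℝ) 1) (t : ℝ) :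
    HasSum (fun n : ℕ => t ^ n / n.factorial * ∫ ω, V ω ^ n ∂P) (mgf V P t) := by
  have h_bound (n : ℕ) : ∀ᵐ ω ∂P, ‖t ^ n / n.factorial * V ω ^ n‖ ≤ |t| ^ n / n.factorial := by
    filter_upwards [hV01] with ω hω
    rw [norm_mul, norm_div, norm_pow, norm_pow, Real.norm_eq_abs, Real.norm_natCast]
    refine mul_le_of_le_one_right (by positivity) (pow_le_one₀ (norm_nonneg _) ?_)
    rw [Real.norm_of_nonneg hω.1]
    exact hω.2
  have h_int (n : ℕ) : Integrable (fun ω => t ^ n / n.factorial * V ω ^ n) P :=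
    .of_bound ((hV.pow_const n).const_mul _).aestronglyMeasurable _ (h_bound n)
  have h_sum : Summable fun n : ℕ => ∫ ω, ‖t ^ n / n.factorial * V ω ^ n‖ ∂P := by
    refine .of_nonneg_of_le (fun n => integral_nonneg fun ω => norm_nonneg _) (fun n => ?_)
      (Real.summable_pow_div_factorial |t|)
    simpa using integral_mono_ae (h_int n).norm (integrable_const _) (h_bound n)
  have h_mgf : mgf V P t = ∫ ω, ∑' n : ℕ, t ^ n / n.factorial * V ω ^ n ∂P := by
    refine integral_congr_ae (ae_of_all _ fun ω => ?_)
    have := (NormedSpace.expSeries_div_hasSum_exp (t * V ω)).tsum_eq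
    simp only [← Real.exp_eq_exp_ℝ] at this
    simp only [← this]
    exact tsum_congr fun n => by rw [mul_pow]; ring
  simpa only [h_mgf, integral_const_mul] using
    hasSum_integral_of_summable_integral_norm h_int h_sum

/-- Two `[0, 1]`-valued random variables with the same moments have the same law. -/
lemma map_eq_of_forall_integral_pow_eq {Ω : Type*} [MeasurableSpace Ω] {P : Measure Ω}
    [IsProbabilityMeasure P] {V W : Ω → ℝ} (hV : AEMeasurable V P) (hW : AEMeasurable W P)
    (hV01 : ∀ᵐ ω ∂P, V ω ∈ Icc (0 : ℝ) 1) (hW01 : ∀ᵐ ω ∂P, W ω ∈ Icc (0 : ℝ) 1)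
    (h : ∀ n : ℕ, ∫ ω, V ω ^ n ∂P = ∫ ω, W ω ^ n ∂P) :
    P.map V = P.map W := by
  have h_mgf : mgf V P = mgf W P := by
    ext t
    have h1 := hasSum_mgf_of_mem_Icc hV hV01 t
    simp only [h] at h1
    exact h1.unique (hasSum_mgf_of_mem_Icc hW hW01 t)
  have h_univ : integrableExpSet V P = univ :=
    eq_univ_of_forall fun t => integrable_exp_mul_of_mem_Icc hV hV01
  refine Measure.ext_of_complexMGF_eq hV hW (funext fun z => eqOn_complexMGF_of_mgf h_mgf ?_)
  simp [h_univ]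

/-- Nonnegative random variables with the same Laplace transform have the same law. -/
lemma map_eq_of_forall_integral_exp_neg_eq {Ω : Type*} [MeasurableSpace Ω] {P : Measure Ω}
    [IsProbabilityMeasure P] {X Y : Ω → ℝ} (hX : AEMeasurable X P) (hY : AEMeasurable Y P)
    (hX0 : ∀ᵐ ω ∂P, 0 ≤ X ω) (hY0 : ∀ᵐ ω ∂P, 0 ≤ Y ω)
    (h : ∀ u : ℝ, 0 ≤ u → ∫ ω, exp (-(u * X ω)) ∂P = ∫ ω, exp (-(u * Y ω)) ∂P) :
    P.map X = P.map Y := by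
  have h_exp : P.map (fun ω => exp (-X ω)) = P.map (fun ω => exp (-Y ω)) := by
    refine map_eq_of_forall_integral_pow_eq (by fun_prop) (by fun_prop) ?_ ?_ fun n => ?_
    · filter_upwards [hX0] with ω hω using ⟨by positivity, by simpa⟩
    · filter_upwards [hY0] with ω hω using ⟨by positivity, by simpa⟩
    · simpa only [← Real.exp_nat_mul, mul_neg] using h n n.cast_nonneg
  have key {Z : Ω → ℝ} (hZ : AEMeasurable Z P) :
      (P.map fun ω => exp (-Z ω)).map (fun x => -log x) = P.map Z := by
    rw [AEMeasurable.map_map_of_aemeasurable (by fun_prop) (by fun_prop)]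
    congr 1
    ext ω
    simp
  rw [← key hX, h_exp, key hY]

/-- A random variable whose Laplace transform is `exp (-(τ * u ^ β))` is almost surely positive. -/
lemma ae_pos_of_integral_exp_neg_eq {Ω : Type*} [MeasurableSpace Ω] {P : Measure Ω}
    [IsProbabilityMeasure P] {X : Ω → ℝ} {β τ : ℝ} (hβ : 0 < β) (hτ : 0 < τ)
    (h : ∀ u : ℝ, 0 ≤ u → ∫ ω, exp (-(u * X ω)) ∂P = exp (-(τ * u ^ β))) :
    ∀ᵐ ω ∂P, 0 < X ω := by
  have h_le (u : ℝ) (hu : 0 ≤ u) : P.real {ω | X ω ≤ 0} ≤ exp (-(τ * u ^ β)) := by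
    have h_int : Integrable (fun ω => exp (-u * X ω)) P :=
      .of_integral_ne_zero (by simp only [neg_mul, h u hu]; positivity)
    have := measure_le_le_exp_mul_mgf 0 (neg_nonpos.2 hu) h_int
    simpa only [mgf, neg_mul, h u hu, mul_zero, neg_zero, exp_zero, one_mul] using this
  have h_lim : Tendsto (fun u : ℝ => exp (-(τ * u ^ β))) atTop (𝓝 0) :=
    tendsto_exp_neg_atTop_nhds_zero.comp ((tendsto_rpow_atTop hβ).const_mul_atTop hτ)
  have h_zero : P.real {ω | X ω ≤ 0} = 0 :=
    le_antisymm (ge_of_tendsto h_lim ((eventually_ge_atTop 0).mono h_le)) measureReal_nonneg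
  rw [measureReal_eq_zero_iff] at h_zero
  simpa [ae_iff] using h_zero

/-- The negative moments of a positive random variable whose Laplace transform is
`exp (-u ^ β)`. -/
lemma lintegral_rpow_neg_of_integral_exp_neg_eq {Ω : Type*} [MeasurableSpace Ω] {P : Measure Ω}
    [IsProbabilityMeasure P] {X : Ω → ℝ} {β s : ℝ} (hβ : 0 < β) (hs : 0 < s)
    (hX : AEMeasurable X P) (hX0 : ∀ᵐ ω ∂P, 0 < X ω)
    (h : ∀ u : ℝ, 0 ≤ u → ∫ ω, exp (-(u * X ω)) ∂P = exp (-u ^ β)) :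
    ∫⁻ ω, ENNReal.ofReal (X ω ^ (-s)) ∂P =
      ENNReal.ofReal (Real.Gamma (s / β) / (β * Real.Gamma s)) := by
  have hΓ : 0 < Real.Gamma s := Gamma_pos_of_pos hs
  have h_inner (r : ℝ) (hr : 0 < r) :
      ∫⁻ u in Ioi 0, ENNReal.ofReal (u ^ (s - 1) * exp (-(u * r))) =
        ENNReal.ofReal (r ^ (-s)) * ENNReal.ofReal (Real.Gamma s) := by
    have h_val := Real.integral_rpow_mul_exp_neg_mul_Ioi hs hr
    simp only [mul_comm r] at h_val
    rw [← ofReal_integral_eq_lintegral_ofReal, h_val, ← ENNReal.ofReal_mul (by positivity),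
      one_div, inv_rpow hr.le, rpow_neg hr.le]
    · exact .of_integral_ne_zero (by rw [h_val]; positivity)
    · filter_upwards [ae_restrict_mem measurableSet_Ioi] with u hu
      have : 0 < u := hu
      simp only [Pi.zero_apply]
      positivity
  have h_outer (u : ℝ) (hu : 0 < u) :
      ∫⁻ ω, ENNReal.ofReal (u ^ (s - 1) * exp (-(u * X ω))) ∂P =
        ENNReal.ofReal (u ^ (s - 1) * exp (-u ^ β)) := by
    rw [← h u hu.le, ← integral_const_mul, ofReal_integral_eq_lintegral_ofReal]
    · exact (Integrable.of_integral_ne_zero (by rw [h u hu.le]; positivity)).const_mul _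
    · exact ae_of_all _ fun ω => by simp only [Pi.zero_apply]; positivity
  have h_val := integral_rpow_mul_exp_neg_rpow hβ (by linarith : -1 < s - 1)
  have h_total : (∫⁻ ω, ENNReal.ofReal (X ω ^ (-s)) ∂P) * ENNReal.ofReal (Real.Gamma s) =
      ENNReal.ofReal (1 / β * Real.Gamma (s / β)) := by
    rw [← lintegral_mul_const' _ _ ENNReal.ofReal_ne_top]
    calc ∫⁻ ω, ENNReal.ofReal (X ω ^ (-s)) * ENNReal.ofReal (Real.Gamma s) ∂P
        = ∫⁻ ω, (∫⁻ u in Ioi 0, ENNReal.ofReal (u ^ (s - 1) * exp (-(u * X ω)))) ∂P :=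
          lintegral_congr_ae <| hX0.mono fun ω hω => (h_inner _ hω).symm
      _ = ∫⁻ u in Ioi 0, (∫⁻ ω, ENNReal.ofReal (u ^ (s - 1) * exp (-(u * X ω))) ∂P) := by
          refine lintegral_lintegral_swap ?_
          have : AEMeasurable (fun p : Ω × ℝ => X p.1) (P.prod (volume.restrict (Ioi 0))) :=
            hX.comp_fst
          simp only [Function.uncurry_def]
          fun_prop
      _ = ∫⁻ u in Ioi 0, ENNReal.ofReal (u ^ (s - 1) * exp (-u ^ β)) :=
          setLIntegral_congr_fun measurableSet_Ioi fun u hu => h_outer u hu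
      _ = ENNReal.ofReal (1 / β * Real.Gamma (s / β)) := by
          rw [sub_add_cancel] at h_val
          have := Gamma_pos_of_pos (div_pos hs hβ)
          rw [← h_val, ofReal_integral_eq_lintegral_ofReal]
          · exact .of_integral_ne_zero (by rw [h_val]; positivity)
          · filter_upwards [ae_restrict_mem measurableSet_Ioi] with u hu
            have : 0 < u := hu
            simp only [Pi.zero_apply]
            positivity
  rw [ENNReal.eq_div_iff (by simpa using hΓ) ENNReal.ofReal_ne_top |>.2
    ((mul_comm _ _).trans h_total), ← ENNReal.ofReal_div_of_pos hΓ]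
  congr 1
  field_simp

/-- Comparing tail probabilities pointwise identifies the moments, as the strict and the weak tails
only differ at countably many levels. -/
lemma lintegral_rpow_eq_of_meas_le_of_meas_le {Ω : Type*} [MeasurableSpace Ω] {P : Measure Ω}
    {f g : Ω → ℝ} (hf0 : 0 ≤ᵐ[P] f) (hg0 : 0 ≤ᵐ[P] g) (hf : AEMeasurable f P)
    (hg : AEMeasurable g P) {p : ℝ} (hp : 0 < p)
    (h_lt : ∀ τ : ℝ, 0 < τ → P {ω | τ < f ω} ≤ P {ω | τ ≤ g ω})
    (h_le : ∀ τ : ℝ, 0 < τ → P {ω | τ ≤ g ω} ≤ P {ω | τ ≤ f ω}) :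
    ∫⁻ ω, ENNReal.ofReal (f ω ^ p) ∂P = ∫⁻ ω, ENNReal.ofReal (g ω ^ p) ∂P := by
  apply le_antisymm
  · rw [lintegral_rpow_eq_lintegral_meas_lt_mul P hf0 hf hp,
      lintegral_rpow_eq_lintegral_meas_le_mul P hg0 hg hp]
    exact mul_right_mono (setLIntegral_mono' measurableSet_Ioi
      fun τ hτ => mul_left_mono (h_lt τ hτ))
  · rw [lintegral_rpow_eq_lintegral_meas_le_mul P hf0 hf hp,
      lintegral_rpow_eq_lintegral_meas_le_mul P hg0 hg hp]
    exact mul_right_mono (setLIntegral_mono' measurableSet_Ioi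
      fun τ hτ => mul_left_mono (h_le τ hτ))

section FirstPassage

variable {f : ℝ → ℝ} {t τ : ℝ}

lemma firstPassage_nonneg : 0 ≤ sInf {τ : ℝ | 0 < τ ∧ t < f τ} :=
  Real.sInf_nonneg fun _ h => h.1.le

lemma le_of_lt_firstPassage (hτ : 0 < τ) (h : τ < sInf {τ : ℝ | 0 < τ ∧ t < f τ}) : f τ ≤ t := by
  by_contra! hlt
  exact h.not_ge (csInf_le ⟨0, fun _ h => h.1.le⟩ ⟨hτ, hlt⟩)

lemma le_firstPassage (hf : Monotone f) (hne : ∃ τ : ℝ, 0 < τ ∧ t < f τ) (h : f τ ≤ t) :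
    τ ≤ sInf {τ : ℝ | 0 < τ ∧ t < f τ} :=
  le_csInf hne fun _ hσ => le_of_lt <| hf.reflect_lt (h.trans_lt hσ.2)

lemma firstPassage_lt_iff (hf : Monotone f) (hne : ∃ τ : ℝ, 0 < τ ∧ t < f τ) :
    sInf {τ : ℝ | 0 < τ ∧ t < f τ} < τ ↔ ∃ q : ℚ, (0 < (q : ℝ) ∧ (q : ℝ) < τ) ∧ t < f q := by
  rw [csInf_lt_iff (s := {τ : ℝ | 0 < τ ∧ t < f τ}) ⟨0, fun _ h => h.1.le⟩ hne]
  constructor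
  · rintro ⟨σ, ⟨hσ, hlt⟩, hστ⟩
    obtain ⟨q, hq, hqτ⟩ := exists_rat_btwn hστ
    exact ⟨q, ⟨hσ.trans hq, hqτ⟩, hlt.trans_le (hf hq.le)⟩
  · rintro ⟨q, ⟨hq, hqτ⟩, hlt⟩
    exact ⟨q, ⟨hq, hlt⟩, hqτ⟩

end FirstPassage

/-- A process with stable Laplace transforms almost surely exceeds every level. -/
lemma ae_exists_lt_of_integral_exp_neg_eq {Ω : Type*} [MeasurableSpace Ω] {P : Measure Ω}
    [IsProbabilityMeasure P] {U : ℝ → Ω → ℝ} {β : ℝ}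
    (h : ∀ u τ : ℝ, 0 ≤ u → 0 ≤ τ → ∫ ω, exp (-(u * U τ ω)) ∂P = exp (-(τ * u ^ β))) (t : ℝ) :
    ∀ᵐ ω ∂P, ∃ τ : ℝ, 0 < τ ∧ t < U τ ω := by
  have h_le (τ : ℝ) (hτ : 0 < τ) :
      P.real {ω | ¬∃ τ : ℝ, 0 < τ ∧ t < U τ ω} ≤ exp t * exp (-τ) := by
    have h_eq : ∫ ω, exp (-1 * U τ ω) ∂P = exp (-τ) := by simpa using h 1 τ zero_le_one hτ.le
    have h_int : Integrable (fun ω => exp (-1 * U τ ω)) P :=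
      .of_integral_ne_zero (by rw [h_eq]; positivity)
    have := measure_le_le_exp_mul_mgf t (by norm_num) h_int
    rw [mgf, h_eq, neg_neg, one_mul] at this
    refine (measureReal_mono fun ω hω => ?_).trans this
    exact not_lt.1 fun hlt => hω ⟨τ, hτ, hlt⟩
  have h_lim : Tendsto (fun τ : ℝ => exp t * exp (-τ)) atTop (𝓝 0) := by
    simpa using tendsto_exp_neg_atTop_nhds_zero.const_mul (exp t)
  have h_zero : P.real {ω | ¬∃ τ : ℝ, 0 < τ ∧ t < U τ ω} = 0 :=
    le_antisymm (ge_of_tendsto h_lim ((eventually_gt_atTop 0).mono h_le)) measureReal_nonneg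
  rwa [measureReal_eq_zero_iff] at h_zero

/-- The first passage time of a monotone process above a level is measurable. -/
lemma aemeasurable_firstPassage {Ω : Type*} [MeasurableSpace Ω] {P : Measure Ω}
    {U : ℝ → Ω → ℝ} {t : ℝ} (hU_mono : ∀ ω, Monotone fun τ => U τ ω)
    (hU : ∀ τ : ℝ, 0 < τ → AEMeasurable (U τ) P)
    (hne : ∀ᵐ ω ∂P, ∃ τ : ℝ, 0 < τ ∧ t < U τ ω) :
    AEMeasurable (fun ω => sInf {τ : ℝ | 0 < τ ∧ t < U τ ω}) P := by
  refine NullMeasurable.aemeasurable ?_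
  refine @measurable_of_Iio ℝ (NullMeasurableSpace Ω P) _ _ _ _ _ _ _ _ fun τ => ?_
  have h_union : NullMeasurableSet
      (⋃ q : ℚ, ⋃ _ : 0 < (q : ℝ) ∧ (q : ℝ) < τ, {ω | t < U q ω}) P :=
    .iUnion fun q => .iUnion fun hq => nullMeasurableSet_lt aemeasurable_const (hU q hq.1)
  refine h_union.congr ?_
  filter_upwards [hne] with ω hω
  apply propext
  change ω ∈ (⋃ q : ℚ, ⋃ _ : 0 < (q : ℝ) ∧ (q : ℝ) < τ, {ω | t < U q ω}) ↔
    sInf {τ : ℝ | 0 < τ ∧ t < U τ ω} < τ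
  rw [firstPassage_lt_iff (hU_mono ω) hω]
  simp

end StableSubordinator

/-- If `E t` is the inverse of a β-stable subordinator `U` with
`β ∈ (0,1)` (i.e. an increasing process with Laplace transform
`E[exp(-u U τ)] = exp(-τ u^β)`), then for every positive integer `n`,
`E[(E t)^n] = t^{nβ} n! / Γ(nβ + 1)`. -/
theorem stmt_0
    {Ω : Type*} [MeasurableSpace Ω] (P : Measure Ω) [IsProbabilityMeasure P]
    (β : ℝ) (hβ : β ∈ Set.Ioo (0 : ℝ) 1)
    (U : ℝ → Ω → ℝ)
    (hU_mono : ∀ ω, Monotone fun τ => U τ ω)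
    (hU_laplace : ∀ u τ : ℝ, 0 ≤ u → 0 ≤ τ →
      ∫ ω, Real.exp (-(u * U τ ω)) ∂P = Real.exp (-(τ * u ^ β)))
    (E : ℝ → Ω → ℝ)
    (hE : ∀ t ω, E t ω = sInf {τ : ℝ | 0 < τ ∧ t < U τ ω}) :
    ∀ n : ℕ, 0 < n → ∀ t : ℝ, 0 ≤ t →
      ∫ ω, (E t ω) ^ n ∂P
        = t ^ ((n : ℝ) * β) * (n.factorial : ℝ) / Real.Gamma ((n : ℝ) * β + 1) := by
  intro n hn t ht
  obtain ⟨hβ0, -⟩ := hβ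
  have hn' : (0 : ℝ) < n := by exact_mod_cast hn
  have hU_meas (τ : ℝ) (hτ : 0 < τ) : AEMeasurable (U τ) P := by
    have h_int : Integrable (fun ω => exp (-(1 * U τ ω))) P :=
      .of_integral_ne_zero (by rw [hU_laplace 1 τ zero_le_one hτ.le]; positivity)
    exact (aemeasurable_of_aemeasurable_exp h_int.aemeasurable).neg.congr
      (ae_of_all _ fun ω => by simp)
  have hU_pos (τ : ℝ) (hτ : 0 < τ) : ∀ᵐ ω ∂P, 0 < U τ ω :=
    ae_pos_of_integral_exp_neg_eq hβ0 hτ fun u hu => hU_laplace u τ hu hτ.le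
  have h_exists := ae_exists_lt_of_integral_exp_neg_eq hU_laplace t
  have h_law (τ : ℝ) (hτ : 0 < τ) : P.map (U τ) = P.map (fun ω => τ ^ β⁻¹ * U 1 ω) := by
    have hpos : 0 < τ ^ β⁻¹ := rpow_pos_of_pos hτ _
    refine map_eq_of_forall_integral_exp_neg_eq (hU_meas τ hτ)
      ((hU_meas 1 one_pos).const_mul _) ((hU_pos τ hτ).mono fun ω hω => hω.le)
      ((hU_pos 1 one_pos).mono fun ω hω => (mul_pos hpos hω).le) fun u hu => ?_
    have h1 := hU_laplace (u * τ ^ β⁻¹) 1 (by positivity) zero_le_one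
    rw [mul_rpow hu hpos.le, rpow_inv_rpow hτ.le hβ0.ne', one_mul] at h1
    simp only [← mul_assoc, hU_laplace u τ hu hτ.le, h1, mul_comm τ]
  have h_scaled (τ : ℝ) (hτ : 0 < τ) :
      P {ω | τ ≤ (t / U 1 ω) ^ β} = P {ω | U τ ω ≤ t} := by
    have h_Iic := congrArg (fun μ : Measure ℝ => μ (Set.Iic t)) (h_law τ hτ)
    simp only [Measure.map_apply_of_aemeasurable (hU_meas τ hτ) measurableSet_Iic,
      Measure.map_apply_of_aemeasurable ((hU_meas 1 one_pos).const_mul _) measurableSet_Iic]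
      at h_Iic
    refine Eq.trans ?_ h_Iic.symm
    refine measure_congr ?_
    filter_upwards [hU_pos 1 one_pos] with ω hω
    apply propext
    change τ ≤ (t / U 1 ω) ^ β ↔ τ ^ β⁻¹ * U 1 ω ≤ t
    rw [← rpow_inv_le_iff_of_pos hτ.le (by positivity) hβ0, le_div_iff₀ hω]
  have hE_meas : AEMeasurable (E t) P := by
    simpa only [← hE] using aemeasurable_firstPassage hU_mono hU_meas h_exists
  have hE_nonneg (ω : Ω) : 0 ≤ E t ω := hE t ω ▸ firstPassage_nonneg
  have hY_nonneg : ∀ᵐ ω ∂P, 0 ≤ (t / U 1 ω) ^ β := by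
    filter_upwards [hU_pos 1 one_pos] with ω hω
    positivity
  have h_eq : ∫⁻ ω, ENNReal.ofReal (E t ω ^ (n : ℝ)) ∂P =
      ∫⁻ ω, ENNReal.ofReal (((t / U 1 ω) ^ β) ^ (n : ℝ)) ∂P := by
    have := hU_meas 1 one_pos
    refine lintegral_rpow_eq_of_meas_le_of_meas_le (ae_of_all _ hE_nonneg) hY_nonneg hE_meas
      (by fun_prop) hn' (fun τ hτ => ?_) (fun τ hτ => ?_)
    · rw [h_scaled τ hτ]
      exact measure_mono fun ω (hω : τ < E t ω) => le_of_lt_firstPassage hτ (hE t ω ▸ hω)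
    · rw [h_scaled τ hτ]
      refine measure_mono_ae ?_
      filter_upwards [h_exists] with ω hω hle
      change τ ≤ E t ω
      exact hE t ω ▸ le_firstPassage (hU_mono ω) hω hle
  have h_split : ∫⁻ ω, ENNReal.ofReal (((t / U 1 ω) ^ β) ^ (n : ℝ)) ∂P =
      ENNReal.ofReal (t ^ ((n : ℝ) * β)) *
        ∫⁻ ω, ENNReal.ofReal (U 1 ω ^ (-((n : ℝ) * β))) ∂P := by
    rw [← lintegral_const_mul' _ _ ENNReal.ofReal_ne_top]
    refine lintegral_congr_ae ?_
    filter_upwards [hU_pos 1 one_pos] with ω hω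
    rw [← ENNReal.ofReal_mul (by positivity), ← rpow_mul (by positivity), mul_comm β,
      div_rpow ht hω.le, rpow_neg hω.le, div_eq_mul_inv]
  have hs : 0 < (n : ℝ) * β := by positivity
  have h_moment := lintegral_rpow_neg_of_integral_exp_neg_eq hβ0 hs (hU_meas 1 one_pos)
    (hU_pos 1 one_pos) fun u hu => by simpa using hU_laplace u 1 hu zero_le_one
  have hΓ := Gamma_pos_of_pos hs
  simp only [rpow_natCast _ n] at h_eq h_split
  rw [integral_eq_lintegral_of_nonneg_ae (ae_of_all _ fun ω => pow_nonneg (hE_nonneg ω) n)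
    (hE_meas.pow_const n).aestronglyMeasurable, h_eq, h_split, h_moment,
    ← ENNReal.ofReal_mul (by positivity), mul_div_cancel_right₀ _ hβ0.ne', Gamma_add_one hs.ne']
  have hfac : (n.factorial : ℝ) = n * Real.Gamma n := by
    rw [← Gamma_add_one hn'.ne', Gamma_nat_eq_factorial]
  have := Gamma_pos_of_pos hn'
  rw [ENNReal.toReal_ofReal (by positivity), hfac]
  field_simp
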